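/- For every natural number $k$, there do not exist rational numbers $\mu_1 > \mu_2 > \mu_3 > \mu_4 > \mu_5 > \mu_6$ with $2\mu_i \in \mathbb{Z}$ for all $i$, such that the tuple $(2\mu_1 - 3,\ 2\mu_2 - 1,\ 2\mu_3 + 1,\ 2\mu_4 + 1,\ 2\mu_5 + 3,\ 2\mu_6 - 5)$ is a permutation of the tuple $(k, k, k, -k, -k, -k)$. -/

import Mathlib

/-- For every natural number `k`, there are no half-integers
`μ₁ > μ₂ > μ₃ > μ₄ > μ₅ > μ₆` such that
`(2μ₁-3, 2μ₂-1, 2μ₃+1, 2μ₄+1, 2μ₅+3, 2μ₆-5)` is a permutation of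
`(k, k, k, -k, -k, -k)`. -/
theorem no_discrete_series_parameter (k : ℕ) :
    ¬ ∃ μ : Fin 6 → ℚ,
      (∀ i j : Fin 6, i < j → μ j < μ i) ∧
      (∀ i : Fin 6, ∃ m : ℤ, 2 * μ i = (m : ℚ)) ∧
      ∃ σ : Equiv.Perm (Fin 6), ∀ i : Fin 6,
        ![2 * μ 0 - 3, 2 * μ 1 - 1, 2 * μ 2 + 1, 2 * μ 3 + 1, 2 * μ 4 + 3, 2 * μ 5 - 5] i
          = ![(k : ℚ), (k : ℚ), (k : ℚ), -(k : ℚ), -(k : ℚ), -(k : ℚ)] (σ i) := by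
  rintro ⟨μ, hμ, -, σ, hσ⟩
  have values (j : Fin 6) :
      ![(k : ℚ), (k : ℚ), (k : ℚ), -(k : ℚ), -(k : ℚ), -(k : ℚ)] j = k ∨
        ![(k : ℚ), (k : ℚ), (k : ℚ), -(k : ℚ), -(k : ℚ), -(k : ℚ)] j = -k := by
    fin_cases j <;> simp
  have h₂ : 2 * μ 2 + 1 = k ∨ 2 * μ 2 + 1 = -k := (values (σ 2)).imp (hσ 2).trans (hσ 2).trans
  have h₃ : 2 * μ 3 + 1 = k ∨ 2 * μ 3 + 1 = -k := (values (σ 3)).imp (hσ 3).trans (hσ 3).trans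
  have h₄ : 2 * μ 4 + 3 = k ∨ 2 * μ 4 + 3 = -k := (values (σ 4)).imp (hσ 4).trans (hσ 4).trans
  have h₅ : 2 * μ 5 - 5 = k ∨ 2 * μ 5 - 5 = -k := (values (σ 5)).imp (hσ 5).trans (hσ 5).trans
  have h₂₃ := hμ 2 3 (by decide)
  have h₃₄ := hμ 3 4 (by decide)
  have h₄₅ := hμ 4 5 (by decide)
  have hk : (0 : ℚ) ≤ k := k.cast_nonneg
  rcases h₂ with h₂ | h₂ <;> rcases h₃ with h₃ | h₃ <;> rcases h₄ with h₄ | h₄ <;>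
    rcases h₅ with h₅ | h₅ <;> linarith
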